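/- arXiv:0804.1076 — 4 statements merged into one kernel-verified Lean document; each statement's English description precedes it below -/
import Mathlib

section
/- Let λ > 0 with λ ≠ n²π² for every integer n ≥ 1, and set μ(λ) = 1 − cos(√λ). Let D^{∂V}(μ(λ)) be the space of functions F : V → ℂ with F ≡ 0 on ∂V and, for every v ∈ V∖∂V, ∑_{e: s e = v} F(t e) + ∑_{e: t e = v} F(s e) = (cos√λ)·(deg v)·F(v) (this is the μ(λ)-eigenspace of the standard discrete Laplacian with Dirichlet conditions on ∂V; deg v counts incidences at v, a loop twice). Then the map Φ_λ sending F to the pair (f,F) with f_e(x) = (F(s e)·sin(√λ·(1−x)) + F(t e)·sin(√λ·x))/sin(√λ) is a linear isomorphism from D^{∂V}(μ(λ)) onto N^{∂V}(λ). In particular N^{∂V}(λ) ≠ 0 if and only if μ(λ) is an eigenvalue of the discrete Dirichlet Laplacian, with equal multiplicities. -/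
open Finset
open scoped Classical

variable {V E : Type*}

/-- The number of incidences of edges at the vertex `v` (a loop counts twice). -/
noncomputable def degE [Fintype E] [DecidableEq V] (s t : E → V) (v : V) : ℕ :=
  (univ.filter fun e => s e = v).card + (univ.filter fun e => t e = v).card

/-- The `λ`-eigenspace `N^{∂V}(λ)` of the Kirchhoff Laplacian of the equilateral
metric graph associated to `(V,E,s,t)` with Dirichlet conditions on `∂V`,
modelled as the set of pairs `(f,F)` of edge functions solving `f'' = −λ f` and
vertex values, subject to continuity, Dirichlet and Kirchhoff conditions. -/
noncomputable def metricEigenspace [Fintype E] [DecidableEq V] (s t : E → V)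
    (bd : Finset V) (lam : ℝ) : Set ((E → ℝ → ℂ) × (V → ℂ)) :=
  {p | (∀ e, ContDiff ℝ 2 (p.1 e)) ∧
    (∀ e x, deriv (deriv (p.1 e)) x = -(lam : ℂ) * p.1 e x) ∧
    (∀ e, p.1 e 0 = p.2 (s e)) ∧ (∀ e, p.1 e 1 = p.2 (t e)) ∧
    (∀ v ∈ bd, p.2 v = 0) ∧
    (∀ v, v ∉ bd →
      (∑ e ∈ univ.filter fun e => s e = v, deriv (p.1 e) 0) =
        ∑ e ∈ univ.filter fun e => t e = v, deriv (p.1 e) 1)}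

/-- The solution of `f'' = -ω² f` on `ℝ` with `f 0 = a` and `f 1 = b`. -/
noncomputable def sineInterp (ω : ℝ) (a b : ℂ) (x : ℝ) : ℂ :=
  (a * ((Real.sin (ω * (1 - x)) : ℝ) : ℂ) + b * ((Real.sin (ω * x) : ℝ) : ℂ)) /
    ((Real.sin ω : ℝ) : ℂ)

lemma hasDerivAt_ofReal_sin_mul (ω x : ℝ) :
    HasDerivAt (fun y : ℝ => ((Real.sin (ω * y) : ℝ) : ℂ))
      ((ω : ℂ) * ((Real.cos (ω * x) : ℝ) : ℂ)) x := by
  have h := (((hasDerivAt_id x).const_mul ω).sin).ofReal_comp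
  refine h.congr_deriv ?_
  simp [mul_comm]

lemma hasDerivAt_ofReal_cos_mul (ω x : ℝ) :
    HasDerivAt (fun y : ℝ => ((Real.cos (ω * y) : ℝ) : ℂ))
      (-(ω : ℂ) * ((Real.sin (ω * x) : ℝ) : ℂ)) x := by
  have h := (((hasDerivAt_id x).const_mul ω).cos).ofReal_comp
  refine h.congr_deriv ?_
  simp [mul_comm]

lemma hasDerivAt_sineInterp (ω : ℝ) (a b : ℂ) (x : ℝ) :
    HasDerivAt (sineInterp ω a b)
      ((ω : ℂ) * (b * ((Real.cos (ω * x) : ℝ) : ℂ) -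
        a * ((Real.cos (ω * (1 - x)) : ℝ) : ℂ)) / ((Real.sin ω : ℝ) : ℂ)) x := by
  have h1 := (hasDerivAt_ofReal_sin_mul ω (1 - x)).comp_const_sub 1 x
  have h2 := hasDerivAt_ofReal_sin_mul ω x
  refine (((h1.const_mul a).add (h2.const_mul b)).div_const
    ((Real.sin ω : ℝ) : ℂ)).congr_deriv ?_
  ring

lemma deriv_sineInterp (ω : ℝ) (a b : ℂ) :
    deriv (sineInterp ω a b) = fun x =>
      (ω : ℂ) * (b * ((Real.cos (ω * x) : ℝ) : ℂ) -
        a * ((Real.cos (ω * (1 - x)) : ℝ) : ℂ)) / ((Real.sin ω : ℝ) : ℂ) :=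
  funext fun x => (hasDerivAt_sineInterp ω a b x).deriv

lemma deriv_deriv_sineInterp (ω : ℝ) (a b : ℂ) (x : ℝ) :
    deriv (deriv (sineInterp ω a b)) x = -(ω : ℂ) ^ 2 * sineInterp ω a b x := by
  rw [deriv_sineInterp]
  have h1 := (hasDerivAt_ofReal_cos_mul ω (1 - x)).comp_const_sub 1 x
  have h2 := hasDerivAt_ofReal_cos_mul ω x
  refine (((((h2.const_mul b).sub (h1.const_mul a)).const_mul (ω : ℂ)).div_const
    ((Real.sin ω : ℝ) : ℂ)).congr_deriv ?_).deriv
  unfold sineInterp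
  ring

lemma contDiff_sineInterp (ω : ℝ) (a b : ℂ) : ContDiff ℝ 2 (sineInterp ω a b) := by
  have h : ContDiff ℝ 2 (fun y : ℝ => ((Real.sin (ω * y) : ℝ) : ℂ)) :=
    Complex.ofRealCLM.contDiff.comp (Real.contDiff_sin.comp (contDiff_const.mul contDiff_id))
  have h' : ContDiff ℝ 2 (fun y : ℝ => ((Real.sin (ω * (1 - y)) : ℝ) : ℂ)) :=
    h.comp (contDiff_const.sub contDiff_id)
  exact ((contDiff_const.mul h').add (contDiff_const.mul h)).div_const _

lemma sineInterp_zero {ω : ℝ} (hω : Real.sin ω ≠ 0) (a b : ℂ) : sineInterp ω a b 0 = a := by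
  have h : ((Real.sin ω : ℝ) : ℂ) ≠ 0 := Complex.ofReal_ne_zero.2 hω
  simp only [sineInterp, sub_zero, mul_one, mul_zero, Real.sin_zero, Complex.ofReal_zero, add_zero]
  exact mul_div_cancel_right₀ _ h

lemma sineInterp_one {ω : ℝ} (hω : Real.sin ω ≠ 0) (a b : ℂ) : sineInterp ω a b 1 = b := by
  have h : ((Real.sin ω : ℝ) : ℂ) ≠ 0 := Complex.ofReal_ne_zero.2 hω
  simp only [sineInterp, sub_self, mul_one, mul_zero, Real.sin_zero, Complex.ofReal_zero, zero_add]
  exact mul_div_cancel_right₀ _ h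

/-- A solution of `f'' = -ω² f` is determined by its initial data. -/
lemma eq_cos_add_sin_of_deriv_deriv {ω : ℝ} (hω : ω ≠ 0) {f : ℝ → ℂ} (hf : ContDiff ℝ 2 f)
    (hode : ∀ x, deriv (deriv f) x = -(ω : ℂ) ^ 2 * f x) (x : ℝ) :
    f x = f 0 * ((Real.cos (ω * x) : ℝ) : ℂ) +
      deriv f 0 / ω * ((Real.sin (ω * x) : ℝ) : ℂ) := by
  have hω' : (ω : ℂ) ≠ 0 := Complex.ofReal_ne_zero.2 hω
  have hd : ∀ y, HasDerivAt f (deriv f y) y := fun y =>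
    (hf.differentiable (by norm_num) y).hasDerivAt
  have hf1 : ContDiff ℝ 1 (deriv f) := by
    have : ContDiff ℝ (1 + 1) f := by simpa [one_add_one_eq_two] using hf
    exact (contDiff_succ_iff_deriv.1 this).2.2
  have hdd : ∀ y, HasDerivAt (deriv f) (-(ω : ℂ) ^ 2 * f y) y := fun y =>
    hode y ▸ (hf1.differentiable (by norm_num) y).hasDerivAt
  have hP : ∀ y, HasDerivAt (fun y => f y * ((Real.cos (ω * y) : ℝ) : ℂ) -
      deriv f y / ω * ((Real.sin (ω * y) : ℝ) : ℂ)) 0 y := fun y => by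
    refine (((hd y).mul (hasDerivAt_ofReal_cos_mul ω y)).sub
      (((hdd y).div_const (ω : ℂ)).mul (hasDerivAt_ofReal_sin_mul ω y))).congr_deriv ?_
    field_simp
    ring
  have hQ : ∀ y, HasDerivAt (fun y => f y * ((Real.sin (ω * y) : ℝ) : ℂ) +
      deriv f y / ω * ((Real.cos (ω * y) : ℝ) : ℂ)) 0 y := fun y => by
    refine (((hd y).mul (hasDerivAt_ofReal_sin_mul ω y)).add
      (((hdd y).div_const (ω : ℂ)).mul (hasDerivAt_ofReal_cos_mul ω y))).congr_deriv ?_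
    field_simp
    ring
  have hPc := is_const_of_deriv_eq_zero (fun y => (hP y).differentiableAt)
    (fun y => (hP y).deriv) x 0
  have hQc := is_const_of_deriv_eq_zero (fun y => (hQ y).differentiableAt)
    (fun y => (hQ y).deriv) x 0
  simp only [mul_zero, Real.cos_zero, Real.sin_zero, Complex.ofReal_one, Complex.ofReal_zero,
    mul_one, sub_zero, zero_add] at hPc hQc
  have hsc : ((Real.sin (ω * x) : ℝ) : ℂ) ^ 2 + ((Real.cos (ω * x) : ℝ) : ℂ) ^ 2 = 1 := by
    exact_mod_cast Real.sin_sq_add_cos_sq (ω * x)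
  rw [← hPc, ← hQc]
  linear_combination -(f x) * hsc

lemma eq_sineInterp_of_deriv_deriv {ω : ℝ} (hω : Real.sin ω ≠ 0) {f : ℝ → ℂ}
    (hf : ContDiff ℝ 2 f) (hode : ∀ x, deriv (deriv f) x = -(ω : ℂ) ^ 2 * f x) :
    f = sineInterp ω (f 0) (f 1) := by
  have hω0 : ω ≠ 0 := by
    rintro rfl
    exact hω Real.sin_zero
  have h : ((Real.sin ω : ℝ) : ℂ) ≠ 0 := Complex.ofReal_ne_zero.2 hω
  have hsol := eq_cos_add_sin_of_deriv_deriv hω0 hf hode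
  funext x
  have h1 := hsol 1
  rw [mul_one] at h1
  rw [sineInterp, eq_div_iff h, h1, hsol x, mul_sub, mul_one, Real.sin_sub]
  push_cast
  ring

/-- The Kirchhoff condition at `v` for the interpolation of `F` is the discrete
eigenvalue equation at `v`. -/
lemma kirchhoff_sineInterp_iff [Fintype E] [DecidableEq V] (s t : E → V) {ω : ℝ}
    (hω : Real.sin ω ≠ 0) (F : V → ℂ) (v : V) :
    ((∑ e ∈ univ.filter fun e => s e = v, deriv (sineInterp ω (F (s e)) (F (t e))) 0) =
        ∑ e ∈ univ.filter fun e => t e = v, deriv (sineInterp ω (F (s e)) (F (t e))) 1) ↔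
      (∑ e ∈ univ.filter fun e => s e = v, F (t e)) +
          (∑ e ∈ univ.filter fun e => t e = v, F (s e)) =
        ((Real.cos ω : ℝ) : ℂ) * (degE s t v : ℂ) * F v := by
  have hω0 : (ω : ℂ) ≠ 0 := by
    rw [Complex.ofReal_ne_zero]
    rintro rfl
    exact hω Real.sin_zero
  have h : ((Real.sin ω : ℝ) : ℂ) ≠ 0 := Complex.ofReal_ne_zero.2 hω
  have h0 : (∑ e ∈ univ.filter fun e => s e = v, deriv (sineInterp ω (F (s e)) (F (t e))) 0) =
      (ω : ℂ) / ((Real.sin ω : ℝ) : ℂ) * ((∑ e ∈ univ.filter fun e => s e = v, F (t e)) -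
        ((univ.filter fun e => s e = v).card : ℂ) * (F v * ((Real.cos ω : ℝ) : ℂ))) := by
    rw [← nsmul_eq_mul, ← sum_const, ← sum_sub_distrib, mul_sum]
    refine sum_congr rfl fun e he => ?_
    rw [deriv_sineInterp, (mem_filter.1 he).2]
    simp only [mul_zero, sub_zero, mul_one, Real.cos_zero, Complex.ofReal_one]
    ring
  have h1 : (∑ e ∈ univ.filter fun e => t e = v, deriv (sineInterp ω (F (s e)) (F (t e))) 1) =
      (ω : ℂ) / ((Real.sin ω : ℝ) : ℂ) *
        (((univ.filter fun e => t e = v).card : ℂ) * (F v * ((Real.cos ω : ℝ) : ℂ)) -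
          ∑ e ∈ univ.filter fun e => t e = v, F (s e)) := by
    rw [← nsmul_eq_mul, ← sum_const, ← sum_sub_distrib, mul_sum]
    refine sum_congr rfl fun e he => ?_
    rw [deriv_sineInterp, (mem_filter.1 he).2]
    simp only [mul_zero, sub_self, mul_one, Real.cos_zero, Complex.ofReal_one]
    ring
  rw [h0, h1, mul_right_inj' (div_ne_zero hω0 h), degE, Nat.cast_add]
  constructor <;> intro H <;> linear_combination H

lemma sin_sqrt_ne_zero {lam : ℝ} (hlam : 0 < lam)
    (hexc : ∀ n : ℕ, 1 ≤ n → lam ≠ (n : ℝ) ^ 2 * Real.pi ^ 2) :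
    Real.sin (Real.sqrt lam) ≠ 0 := by
  intro h
  obtain ⟨n, hn⟩ := Real.sin_eq_zero_iff.1 h
  have hsq : lam = (n : ℝ) ^ 2 * Real.pi ^ 2 := by
    rw [← mul_pow, hn, Real.sq_sqrt hlam.le]
  have hn0 : n ≠ 0 := by
    rintro rfl
    simp at hsq
    exact hlam.ne' hsq
  refine hexc n.natAbs (Nat.one_le_iff_ne_zero.2 (Int.natAbs_ne_zero.2 hn0)) ?_
  rw [hsq, Nat.cast_natAbs, Int.cast_abs, sq_abs]

/-- **Spectral relation between the equilateral metric graph and the discrete graph.**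
For `λ > 0` not of the form `n²π²`, the map `Φ_λ` interpolating a discrete
Dirichlet eigenfunction `F` (for the eigenvalue `μ(λ) = 1 − cos √λ` of the
standard discrete Laplacian with Dirichlet conditions on `∂V`) along the edges
by `f_e(x) = (F(s e)·sin(√λ(1−x)) + F(t e)·sin(√λ x))/sin √λ` is a linear
isomorphism onto the metric eigenspace `N^{∂V}(λ)`. -/
theorem metric_discrete_eigenspace_isomorphism
    [Fintype V] [Fintype E] [DecidableEq V] [Nonempty V] [Nonempty E]
    (s t : E → V)
    (hconn : ∀ v w : V, Relation.EqvGen (fun a b => ∃ e, s e = a ∧ t e = b) v w)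
    (hend : ∀ v : V, ∃ e : E, s e = v ∨ t e = v)
    (bd : Finset V)
    (lam : ℝ) (hlam : 0 < lam)
    (hexc : ∀ n : ℕ, 1 ≤ n → lam ≠ (n : ℝ) ^ 2 * Real.pi ^ 2) :
    letI Φ : (V → ℂ) → (E → ℝ → ℂ) × (V → ℂ) := fun F =>
      (fun e x => (F (s e) * ((Real.sin (Real.sqrt lam * (1 - x)) : ℝ) : ℂ) +
          F (t e) * ((Real.sin (Real.sqrt lam * x) : ℝ) : ℂ)) /
            ((Real.sin (Real.sqrt lam) : ℝ) : ℂ), F)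
    letI D : Set (V → ℂ) := {F | (∀ v ∈ bd, F v = 0) ∧ ∀ v, v ∉ bd →
      (∑ e ∈ univ.filter fun e => s e = v, F (t e)) +
          (∑ e ∈ univ.filter fun e => t e = v, F (s e)) =
        ((Real.cos (Real.sqrt lam) : ℝ) : ℂ) * (degE s t v : ℂ) * F v}
    (∀ F G : V → ℂ, Φ (F + G) = Φ F + Φ G) ∧
    (∀ (c : ℂ) (F : V → ℂ), Φ (c • F) = c • Φ F) ∧
    (∀ F ∈ D, Φ F ∈ metricEigenspace s t bd lam) ∧
    (∀ F ∈ D, ∀ G ∈ D, Φ F = Φ G → F = G) ∧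
    (∀ p ∈ metricEigenspace s t bd lam, ∃ F ∈ D, Φ F = p) := by
  have hsin := sin_sqrt_ne_zero hlam hexc
  have hsq : (lam : ℂ) = (Real.sqrt lam : ℂ) ^ 2 := by
    exact_mod_cast (Real.sq_sqrt hlam.le).symm
  refine ⟨fun F G => ?_, fun c F => ?_, fun F hF => ?_, fun F _ G _ h => congrArg Prod.snd h,
    fun p hp => ?_⟩
  · refine Prod.ext (funext fun e => funext fun x => ?_) rfl
    simp only [Prod.fst_add, Pi.add_apply]
    ring
  · refine Prod.ext (funext fun e => funext fun x => ?_) rfl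
    simp only [Prod.smul_fst, Pi.smul_apply, smul_eq_mul]
    ring
  · refine ⟨fun e => contDiff_sineInterp _ _ _, fun e x => ?_, fun e => sineInterp_zero hsin _ _,
      fun e => sineInterp_one hsin _ _, hF.1, fun v hv => ?_⟩
    · rw [hsq]
      exact deriv_deriv_sineInterp _ _ _ x
    · exact (kirchhoff_sineInterp_iff s t hsin F v).2 (hF.2 v hv)
  · obtain ⟨f, F⟩ := p
    obtain ⟨hC, hode, h0, h1, hbd, hK⟩ := hp
    dsimp only at hC hode h0 h1 hbd hK
    have hf : ∀ e, f e = sineInterp (Real.sqrt lam) (F (s e)) (F (t e)) := fun e => by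
      rw [← h0, ← h1]
      exact eq_sineInterp_of_deriv_deriv hsin (hC e) fun x => by rw [hode e x, hsq]
    refine ⟨F, ⟨hbd, fun v hv => (kirchhoff_sineInterp_iff s t hsin F v).1 ?_⟩,
      Prod.ext (funext fun e => (hf e).symm) rfl⟩
    simpa only [hf] using hK v hv
end

section
/- Let n ≥ 1 be an integer and (f,F) ∈ N^{∂V}(n²π²). Then exactly one of the following holds: (i) F(v) = 0 for all v ∈ V, and in this case f_e(x) = (f_e'(0)/(nπ))·sin(nπx) for every e ∈ E and x ∈ ℝ; or (ii) F(v) ≠ 0 for every v ∈ V, which can occur only if ∂V = ∅, and in this case, if n is even then F is constant, while if n is odd then G is bipartite and F(t e) = −F(s e) for every e ∈ E. -/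
open Finset
open scoped Classical

variable {V E : Type*}

/-- A twice differentiable solution of `g'' = -ω² g` with `ω ≠ 0` is determined by its value and
derivative at `0`. -/
theorem eq_cos_add_sin_of_deriv_deriv_eq {g : ℝ → ℂ} {ω : ℝ} (hω : ω ≠ 0)
    (hg : ContDiff ℝ 2 g) (hode : ∀ x, deriv (deriv g) x = -((ω ^ 2 : ℝ) : ℂ) * g x) (x : ℝ) :
    g x = g 0 * (Real.cos (ω * x) : ℂ) + deriv g 0 / (ω : ℂ) * (Real.sin (ω * x) : ℂ) := by
  have hωc : (ω : ℂ) ≠ 0 := by exact_mod_cast hω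
  have hg1 : ∀ y, HasDerivAt g (deriv g y) y := fun y =>
    (hg.differentiable (by norm_num) y).hasDerivAt
  have hg2 : ∀ y, HasDerivAt (deriv g) (-((ω ^ 2 : ℝ) : ℂ) * g y) y := fun y =>
    hode y ▸ (hg.differentiable_deriv_two y).hasDerivAt
  have hmul : ∀ y : ℝ, HasDerivAt (fun z : ℝ => ω * z) ω y := fun y => by
    simpa using (hasDerivAt_id y).const_mul ω
  have hcos : ∀ y : ℝ, HasDerivAt (fun z : ℝ => (Real.cos (ω * z) : ℂ))
      ((-Real.sin (ω * y) * ω : ℝ) : ℂ) y := fun y => (hmul y).cos.ofReal_comp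
  have hsin : ∀ y : ℝ, HasDerivAt (fun z : ℝ => (Real.sin (ω * z) : ℂ))
      ((Real.cos (ω * y) * ω : ℝ) : ℂ) y := fun y => (hmul y).sin.ofReal_comp
  have ha : ∀ y, HasDerivAt (fun z : ℝ => g z * (Real.cos (ω * z) : ℂ) -
      deriv g z * (Real.sin (ω * z) : ℂ) / ω) 0 y := fun y => by
    refine (((hg1 y).mul (hcos y)).sub (((hg2 y).mul (hsin y)).div_const (ω : ℂ))).congr_deriv ?_
    push_cast
    field_simp
    ring
  have hb : ∀ y, HasDerivAt (fun z : ℝ => g z * (Real.sin (ω * z) : ℂ) +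
      deriv g z * (Real.cos (ω * z) : ℂ) / ω) 0 y := fun y => by
    refine (((hg1 y).mul (hsin y)).add (((hg2 y).mul (hcos y)).div_const (ω : ℂ))).congr_deriv ?_
    push_cast
    field_simp
    ring
  have ha0 := is_const_of_deriv_eq_zero (fun y => (ha y).differentiableAt)
    (fun y => (ha y).deriv) x 0
  have hb0 := is_const_of_deriv_eq_zero (fun y => (hb y).differentiableAt)
    (fun y => (hb y).deriv) x 0
  simp only [mul_zero, Real.cos_zero, Real.sin_zero, Complex.ofReal_one, Complex.ofReal_zero,
    mul_one, zero_div, sub_zero, zero_add] at ha0 hb0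
  have hcs : (Real.sin (ω * x) : ℂ) ^ 2 + (Real.cos (ω * x) : ℂ) ^ 2 = 1 := by
    exact_mod_cast Real.sin_sq_add_cos_sq (ω * x)
  rw [← ha0, ← hb0]
  linear_combination -(g x) * hcs

/-- Generating pairs of an equivalence relation along which a function agrees up to sign force the
function to agree up to sign on all related pairs. -/
theorem eq_or_eq_neg_of_eqvGen {V M : Type*} [InvolutiveNeg M] {r : V → V → Prop} {F : V → M}
    (h : ∀ a b, r a b → F a = F b ∨ F a = -F b) {v w : V} (hvw : Relation.EqvGen r v w) :
    F v = F w ∨ F v = -F w := by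
  induction hvw with
  | rel a b hab => exact h a b hab
  | refl a => exact Or.inl rfl
  | symm a b _ ih =>
    rcases ih with ih | ih <;> simp [ih]
  | trans a b c _ _ ih₁ ih₂ =>
    rcases ih₁ with h₁ | h₁ <;> rcases ih₂ with h₂ | h₂ <;> simp [h₁, h₂]

/-- **Dichotomy for metric eigenfunctions at the Dirichlet values `λ_n = n²π²`.**
Either the eigenfunction vanishes at all vertices and is a pure sine on each
edge, or it vanishes at no vertex; the latter can occur only without Dirichlet
conditions, and then the vertex values are constant (`n` even) or alternating
with the graph bipartite (`n` odd). -/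
theorem metric_eigenfunction_dichotomy
    [Fintype V] [Fintype E] [DecidableEq V] [Nonempty V] [Nonempty E]
    (s t : E → V)
    (hconn : ∀ v w : V, Relation.EqvGen (fun a b => ∃ e, s e = a ∧ t e = b) v w)
    (hend : ∀ v : V, ∃ e : E, s e = v ∨ t e = v)
    (bd : Finset V) (n : ℕ) (hn : 1 ≤ n)
    (f : E → ℝ → ℂ) (F : V → ℂ)
    (hmem : (f, F) ∈ metricEigenspace s t bd ((n : ℝ) ^ 2 * Real.pi ^ 2)) :
    Xor'
      ((∀ v, F v = 0) ∧
        ∀ e x, f e x = (deriv (f e) 0 / (((n : ℝ) * Real.pi : ℝ) : ℂ)) *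
          ((Real.sin ((n : ℝ) * Real.pi * x) : ℝ) : ℂ))
      ((∀ v, F v ≠ 0) ∧ bd = ∅ ∧
        (Even n → ∀ v w, F v = F w) ∧
        (Odd n → (∃ A : Set V, ∀ e, Xor' (s e ∈ A) (t e ∈ A)) ∧
          ∀ e, F (t e) = - F (s e))) := by
  obtain ⟨hC, hode, h0, h1, hbd, -⟩ := hmem
  dsimp only at hC hode h0 h1 hbd
  have hω : (n : ℝ) * Real.pi ≠ 0 :=
    mul_ne_zero (Nat.cast_ne_zero.2 (by omega)) Real.pi_ne_zero
  have hsol : ∀ e x, f e x = F (s e) * (Real.cos ((n : ℝ) * Real.pi * x) : ℂ) +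
      deriv (f e) 0 / (((n : ℝ) * Real.pi : ℝ) : ℂ) *
        ((Real.sin ((n : ℝ) * Real.pi * x) : ℝ) : ℂ) := fun e x => by
    rw [← h0 e]
    exact eq_cos_add_sin_of_deriv_deriv_eq hω (hC e) (fun y => by rw [hode e y, mul_pow]) x
  have hstep : ∀ e, F (t e) = F (s e) * (-1) ^ n := fun e => by
    rw [← h1 e, hsol e 1, mul_one, Real.sin_nat_mul_pi, Real.cos_nat_mul_pi]
    simp
  have hsign : ∀ v w, F v = F w ∨ F v = -F w := fun v w => by
    refine eq_or_eq_neg_of_eqvGen ?_ (hconn v w)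
    rintro _ _ ⟨e, rfl, rfl⟩
    rw [hstep e]
    rcases neg_one_pow_eq_or ℂ n with h | h <;> simp [h]
  by_cases hz : ∀ v, F v = 0
  · refine Or.inl ⟨⟨hz, fun e x => ?_⟩, fun h => ?_⟩
    · rw [hsol e x, hz, zero_mul, zero_add]
    · obtain ⟨v⟩ := ‹Nonempty V›
      exact h.1 v (hz v)
  · obtain ⟨v₀, hv₀⟩ := not_forall.1 hz
    have hne : ∀ v, F v ≠ 0 := fun v hv => hv₀ (by simpa [hv] using hsign v₀ v)
    refine Or.inr ⟨⟨hne, eq_empty_of_forall_notMem fun v hv => hne v (hbd v hv),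
      fun hn v w => ?_, fun hn => ?_⟩, fun h => hz h.1⟩
    · have hconst : Relation.EqvGen (fun a b => F a = F b) v w :=
        Relation.EqvGen.mono (by rintro _ _ ⟨e, rfl, rfl⟩; simp [hstep e, hn.neg_one_pow])
          v w (hconn v w)
      exact (Equivalence.eqvGen_iff (eq_equivalence.comap F)).1 hconst
    · have halt : ∀ e, F (t e) = -F (s e) := fun e => by simp [hstep e, hn.neg_one_pow]
      refine ⟨⟨{v | F v = F v₀}, fun e => ?_⟩, halt⟩
      simp only [Set.mem_ofPred_eq, halt e]
      have hself : F v₀ ≠ -F v₀ := fun h => hv₀ (self_eq_neg.1 h)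
      rcases hsign (s e) v₀ with h | h
      · exact Or.inl ⟨h, fun h' => hself (h'.symm.trans (by rw [h]))⟩
      · exact Or.inr ⟨by rw [h, neg_neg], fun h' => hself (h'.symm.trans h)⟩
end

section
/- Let n ≥ 1 be an integer, α, η : E → ℂ, and define f_e(x) = α_e·cos(nπx) + η_e·sin(nπx) together with vertex values F given by the common endpoint values (assuming the continuity condition holds). Then f fulfills the Kirchhoff condition at every vertex v ∈ V∖∂V if and only if: when n is even, for every v ∈ V∖∂V one has ∑_{e: t e = v} η_e − ∑_{e: s e = v} η_e = 0 (i.e. η ∈ ker ∂^{rel}); and when n is odd, for every v ∈ V∖∂V one has ∑_{e: t e = v} η_e + ∑_{e: s e = v} η_e = 0 (i.e. η ∈ ker ∂̄^{rel}). -/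
open Finset
open scoped Classical

variable {V E : Type*}

/-- Derivative of a combination of `cos (c x)` and `sin (c x)` with complex coefficients. -/
lemma hasDerivAt_cos_add_sin (a b : ℂ) (c x : ℝ) :
    HasDerivAt (fun y : ℝ => a * ((Real.cos (c * y) : ℝ) : ℂ) + b * ((Real.sin (c * y) : ℝ) : ℂ))
      ((c : ℂ) * (b * ((Real.cos (c * x) : ℝ) : ℂ) - a * ((Real.sin (c * x) : ℝ) : ℂ))) x := by
  have hc : HasDerivAt (fun y : ℝ => c * y) c x := by
    simpa using (hasDerivAt_id x).const_mul c
  refine ((hc.cos.ofReal_comp.const_mul a).add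
    (hc.sin.ofReal_comp.const_mul b)).congr_deriv ?_
  push_cast
  ring

lemma deriv_zero_eq_of_eq_cos_add_sin {a b : ℂ} {g : ℝ → ℂ} {n : ℕ}
    (hg : ∀ x, g x = a * ((Real.cos ((n : ℝ) * Real.pi * x) : ℝ) : ℂ) +
      b * ((Real.sin ((n : ℝ) * Real.pi * x) : ℝ) : ℂ)) :
    deriv g 0 = ((n : ℂ) * (Real.pi : ℂ)) * b := by
  rw [funext hg, (hasDerivAt_cos_add_sin a b _ 0).deriv]
  simp

lemma deriv_one_eq_of_eq_cos_add_sin {a b : ℂ} {g : ℝ → ℂ} {n : ℕ}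
    (hg : ∀ x, g x = a * ((Real.cos ((n : ℝ) * Real.pi * x) : ℝ) : ℂ) +
      b * ((Real.sin ((n : ℝ) * Real.pi * x) : ℝ) : ℂ)) :
    deriv g 1 = ((n : ℂ) * (Real.pi : ℂ)) * ((-1) ^ n * b) := by
  rw [funext hg, (hasDerivAt_cos_add_sin a b _ 1).deriv, mul_one, Real.cos_nat_mul_pi,
    Real.sin_nat_mul_pi]
  push_cast
  ring

/-- **Kirchhoff condition and homology.**
For `f_e(x) = α_e cos(nπx) + η_e sin(nπx)`, the Kirchhoff condition at all
inner vertices holds iff `η ∈ ker ∂^{rel}` (oriented) when `n` is even, resp.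
`η ∈ ker ∂̄^{rel}` (unoriented) when `n` is odd. -/
theorem kirchhoff_condition_iff_homology
    [Fintype V] [Fintype E] [DecidableEq V] [Nonempty V] [Nonempty E]
    (s t : E → V)
    (hconn : ∀ v w : V, Relation.EqvGen (fun a b => ∃ e, s e = a ∧ t e = b) v w)
    (hend : ∀ v : V, ∃ e : E, s e = v ∨ t e = v)
    (bd : Finset V) (n : ℕ) (hn : 1 ≤ n)
    (α η : E → ℂ) (f : E → ℝ → ℂ)
    (hf : ∀ e x, f e x = α e * ((Real.cos ((n : ℝ) * Real.pi * x) : ℝ) : ℂ) +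
      η e * ((Real.sin ((n : ℝ) * Real.pi * x) : ℝ) : ℂ)) :
    (Even n →
      ((∀ v, v ∉ bd →
          (∑ e ∈ univ.filter fun e => s e = v, deriv (f e) 0) =
            ∑ e ∈ univ.filter fun e => t e = v, deriv (f e) 1) ↔
        ∀ v, v ∉ bd →
          (∑ e ∈ univ.filter fun e => t e = v, η e) -
            (∑ e ∈ univ.filter fun e => s e = v, η e) = 0)) ∧
    (Odd n →
      ((∀ v, v ∉ bd →
          (∑ e ∈ univ.filter fun e => s e = v, deriv (f e) 0) =
            ∑ e ∈ univ.filter fun e => t e = v, deriv (f e) 1) ↔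
        ∀ v, v ∉ bd →
          (∑ e ∈ univ.filter fun e => t e = v, η e) +
            (∑ e ∈ univ.filter fun e => s e = v, η e) = 0)) := by
  have hc : (n : ℂ) * (Real.pi : ℂ) ≠ 0 :=
    mul_ne_zero (Nat.cast_ne_zero.mpr (by omega)) (Complex.ofReal_ne_zero.mpr Real.pi_ne_zero)
  simp only [fun e => deriv_zero_eq_of_eq_cos_add_sin (hf e),
    fun e => deriv_one_eq_of_eq_cos_add_sin (hf e), ← Finset.mul_sum, mul_right_inj' hc]
  refine ⟨fun h => ?_, fun h => ?_⟩ <;> refine forall₂_congr fun v _ => ?_ <;> rw [h.neg_one_pow]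
  · rw [one_mul, sub_eq_zero, eq_comm]
  · rw [neg_one_mul, eq_neg_iff_add_eq_zero, add_comm]
end

section
/- Let n ≥ 1 be an integer. (1) If ∂V ≠ ∅ then N^{∂V}(n²π²) = N₀^{∂V}(n²π²), i.e. every eigenfunction vanishes at all vertices. (2) If ∂V = ∅: if n is odd and G is not bipartite then N(n²π²) = N₀(n²π²); otherwise N(n²π²) is the internal direct sum of N₀(n²π²) and the one-dimensional span of the trivial vertex-based eigenfunction φ_n, where for n even φ_n = (f,F) with f_e(x) = cos(nπx) for all e and F ≡ 1, and for n odd (G bipartite with bipartition class A) φ_n = (f,F) with f_e(x) = ε_e·cos(nπx), ε_e = 1 if s e ∈ A and ε_e = −1 if s e ∉ A, and F = 1 on A and F = −1 on V∖A. -/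
open Finset
open scoped Classical

variable {V E : Type*}

/-- The Wronskian argument: a solution of `f'' = -(nπ)² f` satisfies `f 1 = (-1)ⁿ f 0`. -/
theorem apply_one_eq_of_deriv_deriv_eq {f : ℝ → ℂ} {n : ℕ} (hn : 1 ≤ n)
    (hf : ContDiff ℝ 2 f)
    (h : ∀ x, deriv (deriv f) x = -(((n : ℝ) ^ 2 * Real.pi ^ 2 : ℝ) : ℂ) * f x) :
    f 1 = (-1) ^ n * f 0 := by
  set k : ℝ := n * Real.pi with hk
  have hk0 : (k : ℂ) ≠ 0 := by
    have : 0 < k := mul_pos (by exact_mod_cast hn) Real.pi_pos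
    exact_mod_cast this.ne'
  have hf1 : ∀ x, HasDerivAt f (deriv f x) x := fun x =>
    (hf.differentiable (by norm_num) x).hasDerivAt
  have hf2 : ∀ x, HasDerivAt (deriv f) (-(k : ℂ) ^ 2 * f x) x := fun x => by
    have hd : Differentiable ℝ (deriv f) :=
      (ContDiff.deriv' (n := 1) (by simpa [one_add_one_eq_two] using hf)).differentiable
        (by norm_num)
    have := (hd x).hasDerivAt
    rw [h x] at this
    have hc : -(k : ℂ) ^ 2 = -(((n : ℝ) ^ 2 * Real.pi ^ 2 : ℝ) : ℂ) := by
      rw [hk]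
      push_cast
      ring
    rwa [hc]
  have hlin : ∀ x : ℝ, HasDerivAt (fun y : ℝ => k * y) k x := fun x => by
    simpa using (hasDerivAt_id x).const_mul k
  have hsin : ∀ x : ℝ, HasDerivAt (fun y : ℝ => ((Real.sin (k * y) : ℝ) : ℂ))
      ((Real.cos (k * x) * k : ℝ) : ℂ) x := fun x => (hlin x).sin.ofReal_comp
  have hcos : ∀ x : ℝ, HasDerivAt (fun y : ℝ => ((Real.cos (k * y) : ℝ) : ℂ))
      ((-Real.sin (k * x) * k : ℝ) : ℂ) x := fun x => (hlin x).cos.ofReal_comp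
  have hW : ∀ x : ℝ, HasDerivAt (fun y : ℝ =>
      deriv f y * ((Real.sin (k * y) : ℝ) : ℂ) - k * (f y * ((Real.cos (k * y) : ℝ) : ℂ))) 0 x :=
    fun x => by
      refine (((hf2 x).mul (hsin x)).sub (((hf1 x).mul (hcos x)).const_mul (k : ℂ))).congr_deriv ?_
      push_cast
      ring
  have hconst := is_const_of_deriv_eq_zero (fun x => (hW x).differentiableAt)
    (fun x => (hW x).deriv) 1 0
  have hs : Real.sin k = 0 := Real.sin_nat_mul_pi n
  have hc : Real.cos k = (-1) ^ n := Real.cos_nat_mul_pi n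
  simp only [mul_one, mul_zero, Real.sin_zero, Real.cos_zero, hs, hc] at hconst
  push_cast at hconst
  have hfk : f 1 * (-1) ^ n = f 0 := by
    apply mul_left_cancel₀ hk0
    linear_combination -hconst
  have hsq : ((-1 : ℂ) ^ n) * (-1) ^ n = 1 := by
    rw [← mul_pow]
    norm_num
  linear_combination (-1) ^ n * hfk - f 1 * hsq

theorem eq_of_eqvGen_edge {s t : E → V} {α : Type*} {g : V → α}
    (hg : ∀ e, g (s e) = g (t e)) {v w : V}
    (h : Relation.EqvGen (fun a b => ∃ e, s e = a ∧ t e = b) v w) : g v = g w := by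
  induction h with
  | rel _ _ h =>
    obtain ⟨e, rfl, rfl⟩ := h
    exact hg e
  | refl => rfl
  | symm _ _ _ ih => exact ih.symm
  | trans _ _ _ _ _ ih₁ ih₂ => exact ih₁.trans ih₂

section metricEigenspace

variable [Fintype E] [DecidableEq V] {s t : E → V} {bd : Finset V}

theorem sub_smul_mem_metricEigenspace {lam : ℝ} {p q : (E → ℝ → ℂ) × (V → ℂ)}
    (hp : p ∈ metricEigenspace s t bd lam) (hq : q ∈ metricEigenspace s t bd lam) (c : ℂ) :
    p - c • q ∈ metricEigenspace s t bd lam := by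
  obtain ⟨p1, p2, p3, p4, p5, p6⟩ := hp
  obtain ⟨q1, q2, q3, q4, q5, q6⟩ := hq
  have hd : ∀ {r : (E → ℝ → ℂ) × (V → ℂ)}, (∀ e, ContDiff ℝ 2 (r.1 e)) →
      ∀ e x, DifferentiableAt ℝ (deriv (r.1 e)) x := fun hr e x =>
    (ContDiff.deriv' (n := 1) (by simpa [one_add_one_eq_two] using hr e)).differentiable
      (by norm_num) x
  have hderiv : ∀ e, deriv ((p - c • q).1 e) =
      fun x => deriv (p.1 e) x - c * deriv (q.1 e) x := fun e => by
    ext x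
    have h1 := ((p1 e).differentiable (by norm_num) x).hasDerivAt
    have h2 := ((q1 e).differentiable (by norm_num) x).hasDerivAt
    exact (h1.sub (h2.const_mul c)).deriv
  refine ⟨fun e => (p1 e).sub (contDiff_const.mul (q1 e)), fun e x => ?_, fun e => ?_,
    fun e => ?_, fun v hv => ?_, fun v hv => ?_⟩
  · rw [hderiv]
    refine ((hd p1 e x).hasDerivAt.sub ((hd q1 e x).hasDerivAt.const_mul c)).deriv.trans ?_
    rw [p2, q2]
    simp
    ring
  · simp [p3, q3]
  · simp [p4, q4]
  · simp [p5 v hv, q5 v hv]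
  · simp only [hderiv, Finset.sum_sub_distrib, ← Finset.mul_sum]
    rw [p6 v hv, q6 v hv]

theorem cos_mem_metricEigenspace {n : ℕ} {ε : E → ℂ} {F : V → ℂ}
    (hs : ∀ e, F (s e) = ε e) (ht : ∀ e, F (t e) = (-1) ^ n * ε e) :
    ((fun e x => ε e * ((Real.cos ((n : ℝ) * Real.pi * x) : ℝ) : ℂ), F) :
      (E → ℝ → ℂ) × (V → ℂ)) ∈ metricEigenspace s t ∅ ((n : ℝ) ^ 2 * Real.pi ^ 2) := by
  set k : ℝ := n * Real.pi with hk
  have hlin : ∀ x : ℝ, HasDerivAt (fun y : ℝ => k * y) k x := fun x => by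
    simpa using (hasDerivAt_id x).const_mul k
  have hderiv : ∀ e, deriv (fun x : ℝ => ε e * ((Real.cos (k * x) : ℝ) : ℂ)) =
      fun x => ε e * ((-Real.sin (k * x) * k : ℝ) : ℂ) := fun e => by
    ext x
    exact ((hlin x).cos.ofReal_comp.const_mul (ε e)).deriv
  have hsin : Real.sin k = 0 := Real.sin_nat_mul_pi n
  have hcos : Real.cos k = (-1) ^ n := Real.cos_nat_mul_pi n
  refine ⟨fun e => ?_, fun e x => ?_, fun e => ?_, fun e => ?_, by simp, fun v _ => ?_⟩
  · exact contDiff_const.mul (Complex.ofRealCLM.contDiff.comp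
      (Real.contDiff_cos.comp (contDiff_const.mul contDiff_id)))
  · simp only [hderiv]
    refine (((hlin x).sin.neg.mul_const k).ofReal_comp.const_mul (ε e)).deriv.trans ?_
    rw [hk]
    push_cast
    ring
  · simp [hs]
  · simp only [mul_one, hcos, ht]
    push_cast
    ring
  · simp only [hderiv]
    simp [hsin]

variable {n : ℕ} {p : (E → ℝ → ℂ) × (V → ℂ)}

theorem metricEigenspace_snd_target (hn : 1 ≤ n)
    (hp : p ∈ metricEigenspace s t bd ((n : ℝ) ^ 2 * Real.pi ^ 2)) (e : E) :
    p.2 (t e) = (-1) ^ n * p.2 (s e) := by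
  obtain ⟨p1, p2, p3, p4, -, -⟩ := hp
  rw [← p3, ← p4]
  exact apply_one_eq_of_deriv_deriv_eq hn (p1 e) (p2 e)

theorem metricEigenspace_sq_snd_eq (hn : 1 ≤ n)
    (hconn : ∀ v w : V, Relation.EqvGen (fun a b => ∃ e, s e = a ∧ t e = b) v w)
    (hp : p ∈ metricEigenspace s t bd ((n : ℝ) ^ 2 * Real.pi ^ 2)) (v w : V) :
    p.2 v ^ 2 = p.2 w ^ 2 := by
  refine eq_of_eqvGen_edge (g := fun v => p.2 v ^ 2) (fun e => ?_) (hconn v w)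
  simp only [metricEigenspace_snd_target hn hp e, mul_pow, ← pow_mul, mul_comm n 2]
  simp [pow_mul]

theorem existsUnique_sub_smul_mem_metricEigenspace [Nonempty V] (hn : 1 ≤ n)
    (hconn : ∀ v w : V, Relation.EqvGen (fun a b => ∃ e, s e = a ∧ t e = b) v w)
    {q : (E → ℝ → ℂ) × (V → ℂ)} (hq1 : ∀ v, q.2 v * q.2 v = 1)
    (hq : q ∈ metricEigenspace s t bd ((n : ℝ) ^ 2 * Real.pi ^ 2))
    (hp : p ∈ metricEigenspace s t bd ((n : ℝ) ^ 2 * Real.pi ^ 2)) :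
    ∃! c : ℂ, p - c • q ∈ metricEigenspace s t bd ((n : ℝ) ^ 2 * Real.pi ^ 2) ∧
      (p - c • q).2 = 0 := by
  obtain ⟨v₀⟩ := ‹Nonempty V›
  have hconst : ∀ v, p.2 v * q.2 v = p.2 v₀ * q.2 v₀ := fun v => by
    refine eq_of_eqvGen_edge (g := fun v => p.2 v * q.2 v) (fun e => ?_) (hconn v v₀)
    have hsq : ((-1 : ℂ) ^ n) * (-1) ^ n = 1 := by
      rw [← mul_pow]
      norm_num
    simp only [metricEigenspace_snd_target hn hp e, metricEigenspace_snd_target hn hq e]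
    linear_combination -(p.2 (s e) * q.2 (s e)) * hsq
  refine ⟨p.2 v₀ * q.2 v₀, ⟨sub_smul_mem_metricEigenspace hp hq _, ?_⟩, ?_⟩
  · ext v
    simp only [Prod.snd_sub, Prod.smul_snd, Pi.sub_apply, Pi.smul_apply, smul_eq_mul,
      Pi.zero_apply]
    linear_combination q.2 v * hconst v - p.2 v * hq1 v
  · rintro c ⟨-, hc⟩
    have h := congrFun hc v₀
    simp only [Prod.snd_sub, Prod.smul_snd, Pi.sub_apply, Pi.smul_apply, smul_eq_mul,
      Pi.zero_apply] at h
    linear_combination -(c * hq1 v₀) - q.2 v₀ * h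

end metricEigenspace

/-- **Decomposition of the metric eigenspace at `λ_n = n²π²`.**
If `∂V ≠ ∅`, every eigenfunction vanishes at all vertices; the same holds if
`∂V = ∅`, `n` is odd and the graph is not bipartite. Otherwise
`N(n²π²) = N₀(n²π²) ⊕ ℂ·φ_n`, where `φ_n` is the trivial vertex-based
eigenfunction: `φ_n = (cos(nπ·), 1)` for `n` even, and the bipartite signed
version for `n` odd. -/
theorem metric_eigenspace_decomposition
    [Fintype V] [Fintype E] [DecidableEq V] [Nonempty V] [Nonempty E]
    (s t : E → V)
    (hconn : ∀ v w : V, Relation.EqvGen (fun a b => ∃ e, s e = a ∧ t e = b) v w)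
    (hend : ∀ v : V, ∃ e : E, s e = v ∨ t e = v)
    (bd : Finset V) (n : ℕ) (hn : 1 ≤ n) :
    letI lamn : ℝ := (n : ℝ) ^ 2 * Real.pi ^ 2
    letI φeven : (E → ℝ → ℂ) × (V → ℂ) :=
      (fun _ x => ((Real.cos ((n : ℝ) * Real.pi * x) : ℝ) : ℂ), fun _ => 1)
    letI φodd : Set V → (E → ℝ → ℂ) × (V → ℂ) := fun A =>
      (fun e x => (if s e ∈ A then 1 else -1) *
          ((Real.cos ((n : ℝ) * Real.pi * x) : ℝ) : ℂ),
        fun v => if v ∈ A then 1 else -1)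
    (bd.Nonempty → ∀ p ∈ metricEigenspace s t bd lamn, p.2 = 0) ∧
    (bd = ∅ → Odd n → ¬ (∃ A : Set V, ∀ e, Xor' (s e ∈ A) (t e ∈ A)) →
      ∀ p ∈ metricEigenspace s t bd lamn, p.2 = 0) ∧
    (bd = ∅ → Even n →
      φeven ∈ metricEigenspace s t bd lamn ∧
        ∀ p ∈ metricEigenspace s t bd lamn, ∃! c : ℂ,
          p - c • φeven ∈ metricEigenspace s t bd lamn ∧ (p - c • φeven).2 = 0) ∧
    (bd = ∅ → Odd n → ∀ A : Set V, (∀ e, Xor' (s e ∈ A) (t e ∈ A)) →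
      φodd A ∈ metricEigenspace s t bd lamn ∧
        ∀ p ∈ metricEigenspace s t bd lamn, ∃! c : ℂ,
          p - c • φodd A ∈ metricEigenspace s t bd lamn ∧ (p - c • φodd A).2 = 0) := by
  have hodd : ∀ A : Set V, ∀ v, (if v ∈ A then (1 : ℂ) else -1) * (if v ∈ A then 1 else -1) = 1 :=
    fun A v => by split_ifs <;> norm_num
  refine ⟨?_, ?_, ?_, ?_⟩
  · rintro ⟨w, hw⟩ p hp
    ext v
    have h := metricEigenspace_sq_snd_eq hn hconn hp v w
    rw [hp.2.2.2.2.1 w hw] at h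
    simpa using h
  · rintro - hn' hbip p hp
    by_contra hne
    obtain ⟨v₀, hv₀⟩ := Function.ne_iff.mp hne
    refine hbip ⟨{v | p.2 v = p.2 v₀}, fun e => ?_⟩
    have ht := metricEigenspace_snd_target hn hp e
    rw [hn'.neg_one_pow, neg_one_mul] at ht
    have hne' : p.2 v₀ ≠ -p.2 v₀ := fun h => hv₀ (self_eq_neg.mp h)
    simp only [Set.mem_ofPred_eq, ht]
    rcases sq_eq_sq_iff_eq_or_eq_neg.mp
      (metricEigenspace_sq_snd_eq hn hconn hp (s e) v₀) with h | h
    · exact Or.inl ⟨h, fun h' => hne' (by linear_combination -h - h')⟩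
    · exact Or.inr ⟨by rw [h, neg_neg], fun h' => hne' (h'.symm.trans h)⟩
  · rintro rfl hn'
    have hmem := cos_mem_metricEigenspace (s := s) (t := t) (n := n) (ε := fun _ => 1)
      (F := fun _ => 1) (fun _ => rfl) (fun _ => by simp [hn'.neg_one_pow])
    simp only [one_mul] at hmem
    exact ⟨hmem, fun p hp =>
      existsUnique_sub_smul_mem_metricEigenspace hn hconn (fun _ => one_mul 1) hmem hp⟩
  · rintro rfl hn' A hA
    have hmem := cos_mem_metricEigenspace (s := s) (t := t) (n := n)
      (ε := fun e => if s e ∈ A then 1 else -1) (F := fun v => if v ∈ A then 1 else -1)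
      (fun _ => rfl) (fun e => by
        rcases hA e with ⟨h₁, h₂⟩ | ⟨h₁, h₂⟩ <;> simp [h₁, h₂, hn'.neg_one_pow])
    exact ⟨hmem, fun p hp =>
      existsUnique_sub_smul_mem_metricEigenspace hn hconn (hodd A) hmem hp⟩
end
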